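/- Let n ≥ 1 and let σ be a Z-retraction of [0,1]ⁿ whose range R_σ is a closed domain. Then the set of retractions of McN([0,1]ⁿ) onto A_σ is finite; equivalently, there are only finitely many Z-homeomorphism domains for σ. -/

import Mathlib

open Set MeasureTheory

/-- The unit cube `[0,1]^n` in `ℝ^n`. -/
def cubeSet (n : ℕ) : Set (Fin n → ℝ) := Set.Icc 0 1

/-- A point all of whose coordinates are rational. -/
def IsRationalPoint {n : ℕ} (v : Fin n → ℝ) : Prop := ∀ i, ∃ q : ℚ, v i = (q : ℝ)

/-- A rational polyhedron: a finite union of convex hulls of finite sets of rational points. -/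
def IsRationalPolyhedron {n : ℕ} (P : Set (Fin n → ℝ)) : Prop :=
  ∃ S : Finset (Finset (Fin n → ℝ)),
    (∀ F ∈ S, ∀ v ∈ F, IsRationalPoint v) ∧
    P = ⋃ F ∈ S, convexHull ℝ (F : Set (Fin n → ℝ))

/-- An affine map `x ↦ Mx + b` with integer matrix `M` and integer vector `b`. -/
def IsIntAffine {n m : ℕ} (g : (Fin n → ℝ) → (Fin m → ℝ)) : Prop :=
  ∃ (M : Fin m → Fin n → ℤ) (b : Fin m → ℤ),
    ∀ x i, g x i = (∑ j, (M i j : ℝ) * x j) + (b i : ℝ)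

/-- A Z-map on `P`: continuous on `P`, with finitely many integer affine pieces. -/
def IsZMapOn {n m : ℕ} (P : Set (Fin n → ℝ)) (f : (Fin n → ℝ) → (Fin m → ℝ)) : Prop :=
  ContinuousOn f P ∧
  ∃ (k : ℕ) (g : Fin k → (Fin n → ℝ) → (Fin m → ℝ)),
    (∀ i, IsIntAffine (g i)) ∧ ∀ x ∈ P, ∃ i, f x = g i x

/-- `f` restricted to `P` is a Z-homeomorphism of `P` onto `Q`. -/
def IsZHomeoOnto {n m : ℕ} (P : Set (Fin n → ℝ)) (Q : Set (Fin m → ℝ))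
    (f : (Fin n → ℝ) → (Fin m → ℝ)) : Prop :=
  IsZMapOn P f ∧ f '' P = Q ∧ Set.InjOn f P ∧
  ∃ g : (Fin m → ℝ) → (Fin n → ℝ),
    IsZMapOn Q g ∧ (∀ x ∈ P, g (f x) = x) ∧ (∀ y ∈ Q, f (g y) = y)

/-- A Z-retraction of the cube `[0,1]^n`. -/
def IsZRetraction {n : ℕ} (σ : (Fin n → ℝ) → (Fin n → ℝ)) : Prop :=
  IsZMapOn (cubeSet n) σ ∧ Set.MapsTo σ (cubeSet n) (cubeSet n) ∧
  ∀ x ∈ cubeSet n, σ (σ x) = σ x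

/-- The range `R_σ = σ([0,1]^n)` of a Z-retraction. -/
def zRange {n : ℕ} (σ : (Fin n → ℝ) → (Fin n → ℝ)) : Set (Fin n → ℝ) := σ '' cubeSet n

/-- A Z-homeomorphism domain for `σ`: a rational polyhedron `Q ⊆ [0,1]^n` such that
`σ` restricted to `Q` is a Z-homeomorphism of `Q` onto `R_σ`. -/
def IsZHomeoDomain {n : ℕ} (σ : (Fin n → ℝ) → (Fin n → ℝ)) (Q : Set (Fin n → ℝ)) : Prop :=
  IsRationalPolyhedron Q ∧ Q ⊆ cubeSet n ∧ IsZHomeoOnto Q (zRange σ) σ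

/-- A (Kuratowski) closed domain: `D` equals the closure of its interior. -/
def IsClosedDomain {n : ℕ} (D : Set (Fin n → ℝ)) : Prop :=
  closure (interior D) = D

/-- A scalar integer affine map. -/
def IsIntAffine1 {n : ℕ} (g : (Fin n → ℝ) → ℝ) : Prop :=
  ∃ (m : Fin n → ℤ) (b : ℤ), ∀ x, g x = (∑ j, (m j : ℝ) * x j) + (b : ℝ)

/-- A scalar Z-map on `P`. -/
def IsZMapOn1 {n : ℕ} (P : Set (Fin n → ℝ)) (f : (Fin n → ℝ) → ℝ) : Prop :=
  ContinuousOn f P ∧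
  ∃ (k : ℕ) (g : Fin k → (Fin n → ℝ) → ℝ),
    (∀ i, IsIntAffine1 (g i)) ∧ ∀ x ∈ P, ∃ i, f x = g i x

/-- The free MV-algebra `McN([0,1]^n)`, viewed as a set of functions on the cube. -/
def McN (n : ℕ) : Set (↥(cubeSet n) → ℝ) :=
  { f | (∀ x, f x ∈ Set.Icc (0:ℝ) 1) ∧
    ∃ g : (Fin n → ℝ) → ℝ, IsZMapOn1 (cubeSet n) g ∧ ∀ x : ↥(cubeSet n), f x = g x.1 }

/-- Pointwise MV-sum `f ⊕ g = min(f + g, 1)`. -/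
def mvAdd {X : Type*} (f g : X → ℝ) : X → ℝ := fun x => min (f x + g x) 1

/-- Pointwise MV-negation `¬f = 1 - f`. -/
def mvNeg {X : Type*} (f : X → ℝ) : X → ℝ := fun x => 1 - f x

/-- The retract `A_σ = {g ∘ σ : g ∈ McN([0,1]^n)}` associated with a Z-retraction `σ`. -/
def retAlg {n : ℕ} (σ : (Fin n → ℝ) → (Fin n → ℝ)) : Set (↥(cubeSet n) → ℝ) :=
  { f | ∃ g ∈ McN n, ∀ (x : ↥(cubeSet n)) (h : σ x.1 ∈ cubeSet n), f x = g ⟨σ x.1, h⟩ }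

/-- `ε` is a retraction of `McN([0,1]^n)` onto `A`. -/
def IsMcNRetraction {n : ℕ} (ε : ↥(McN n) → ↥(McN n)) (A : Set (↥(cubeSet n) → ℝ)) : Prop :=
  (∀ (f g : ↥(McN n)) (h : mvAdd f.1 g.1 ∈ McN n),
      (ε ⟨mvAdd f.1 g.1, h⟩).1 = mvAdd (ε f).1 (ε g).1) ∧
  (∀ (f : ↥(McN n)) (h : mvNeg f.1 ∈ McN n),
      (ε ⟨mvNeg f.1, h⟩).1 = mvNeg (ε f).1) ∧
  (∀ f, ε (ε f) = ε f) ∧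
  Subtype.val '' Set.range ε = A

/-- An MV-isomorphism between two sets of `[0,1]`-valued functions. -/
def IsMVIsoFun {X Y : Type*} (A : Set (X → ℝ)) (B : Set (Y → ℝ)) (h : ↥A → ↥B) : Prop :=
  Function.Bijective h ∧
  (∀ (f g : ↥A) (hm : mvAdd f.1 g.1 ∈ A),
      (h ⟨mvAdd f.1 g.1, hm⟩).1 = mvAdd (h f).1 (h g).1) ∧
  (∀ (f : ↥A) (hm : mvNeg f.1 ∈ A),
      (h ⟨mvNeg f.1, hm⟩).1 = mvNeg (h f).1)

/-- On `P`, the map `f` selects its values from finitely many affine maps. -/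
def SelectsAffineOn {n m : ℕ} (P : Set (Fin n → ℝ)) (f : (Fin n → ℝ) → (Fin m → ℝ)) : Prop :=
  ∃ s : Set ((Fin n → ℝ) →ᵃ[ℝ] (Fin m → ℝ)), s.Finite ∧ ∀ x ∈ P, ∃ A ∈ s, f x = A x

/-- A continuous selection from finitely many affine maps which are pairwise either equal or
nowhere equal on a preconnected set agrees with one of them on that set. -/
theorem eq_of_selection_of_isPreconnected {ι X Y : Type*} [Finite ι] [TopologicalSpace X]
    [TopologicalSpace Y] [T2Space Y] {K : Set X} (hK : IsPreconnected K) {A : ι → X → Y}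
    (hA : ∀ i, ContinuousOn (A i) K)
    (hdich : ∀ i j, ∀ x ∈ K, ∀ y ∈ K, A i x = A j x → A i y = A j y)
    {f : X → Y} (hf : ContinuousOn f K) (hsel : ∀ x ∈ K, ∃ i, f x = A i x)
    {x y : X} (hx : x ∈ K) (hy : y ∈ K) {i : ι} (hxi : f x = A i x) : f y = A i y := by
  have hcl : ∀ j, ∃ t, IsClosed t ∧ ∀ z ∈ K, z ∈ t ↔ f z = A j z := by
    intro j
    obtain ⟨u, hu, hu'⟩ :=
      continuousOn_iff_isClosed.1 (hf.prodMk (hA j)) _ (isClosed_diagonal (X := Y))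
    refine ⟨u, hu, fun z hz => ?_⟩
    have := Set.ext_iff.1 hu' z
    simp only [mem_inter_iff, hz, and_true] at this
    rw [← this]
    simp
  choose t ht htm using hcl
  by_contra hne
  let J := {j : ι // ∃ z ∈ K, A j z ≠ A i z}
  obtain ⟨j, hj⟩ := hsel y hy
  have hjJ : ∃ z ∈ K, A j z ≠ A i z := ⟨y, hy, fun h => hne (hj.trans h)⟩
  obtain ⟨z, hzK, hz1, hz2⟩ := isPreconnected_closed_iff.1 hK (t i) (⋃ j : J, t j) (ht i)
    (isClosed_iUnion_of_finite fun j => ht j)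
    (by
      intro z hz
      obtain ⟨k, hk⟩ := hsel z hz
      by_cases h : A k z = A i z
      · exact Or.inl ((htm i z hz).2 (hk.trans h))
      · exact Or.inr (mem_iUnion.2 ⟨⟨k, z, hz, h⟩, (htm k z hz).2 hk⟩))
    ⟨x, hx, (htm i x hx).2 hxi⟩
    ⟨y, hy, mem_iUnion.2 ⟨⟨j, hjJ⟩, (htm j y hy).2 hj⟩⟩
  obtain ⟨⟨k, w, hw, hkw⟩, hk⟩ := mem_iUnion.1 hz2
  exact hkw (hdich k i z hzK w hw (((htm k z hzK).1 hk).symm.trans ((htm i z hzK).1 hz1)))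

theorem ordConnected_setOf_sign_eq (s : SignType) :
    OrdConnected {t : ℝ | SignType.sign t = s} := by
  refine ⟨fun a ha b hb c hc => ?_⟩
  simp only [mem_ofPred_eq] at *
  apply le_antisymm
  · exact hb ▸ SignType.sign.monotone hc.2
  · exact ha ▸ SignType.sign.monotone hc.1

/-- On a convex set there are only finitely many continuous selections from a finite set of
affine maps. -/
theorem finite_continuous_affine_selections {n m : ℕ} {C : Set (Fin n → ℝ)} (hC : Convex ℝ C)
    {s : Set ((Fin n → ℝ) →ᵃ[ℝ] (Fin m → ℝ))} (hs : s.Finite) :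
    {φ : C → (Fin m → ℝ) | Continuous φ ∧ ∀ x, ∃ A ∈ s, φ x = A x}.Finite := by
  classical
  have : Finite s := hs
  let sg : (Fin n → ℝ) → (s → s → Fin m → SignType) := fun x A B k =>
    SignType.sign (A.1 x k - B.1 x k)
  let T := {τ // ∃ x : C, sg x = τ}
  have : Finite T := Subtype.finite
  choose r hr using fun τ : T => τ.2
  have key : ∀ φ : C → (Fin m → ℝ), Continuous φ → (∀ x, ∃ A ∈ s, φ x = A x) →
      ∀ x y : C, sg x = sg y → ∀ A ∈ s, φ x = A x → φ y = A y := by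
    intro φ hφ hsel x y hxy A hA hxA
    let K : Set C := {z | sg z = sg y}
    have hKc : Convex ℝ (C ∩ {z | sg z = sg y}) := by
      have : {z | sg z = sg y} = ⋂ (A : s) (B : s) (k : Fin m),
          ((LinearMap.proj k).toAffineMap.comp (A.1 - B.1)) ⁻¹'
            {t : ℝ | SignType.sign t = sg y A B k} := by
        ext z
        simp only [sg, funext_iff, mem_ofPred_eq, mem_iInter, mem_preimage]
        rfl
      rw [this]
      exact hC.inter (convex_iInter fun A => convex_iInter fun B => convex_iInter fun k =>
        (ordConnected_setOf_sign_eq _).convex.affine_preimage _)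
    have hK : IsPreconnected K := by
      rw [← Topology.IsInducing.subtypeVal.isPreconnected_image]
      convert hKc.isPreconnected using 1
      ext z
      simp [K, and_comm]
    refine eq_of_selection_of_isPreconnected (A := fun (B : s) (z : C) => B.1 z) (i := ⟨A, hA⟩)
      hK (fun B => ?_) ?_ hφ.continuousOn (fun z _ => ?_) (show x ∈ K from hxy)
      (show y ∈ K from rfl) hxA
    · exact (B.1.continuous_of_finiteDimensional.comp continuous_subtype_val).continuousOn
    · intro B D z hz w hw hzw
      funext k
      have h1 : sg z B D k = sg w B D k := by rw [show sg z = sg w from hz.trans hw.symm]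
      have h2 : sg z B D k = 0 := by simp [sg, hzw]
      rw [h1] at h2
      exact sub_eq_zero.1 (sign_eq_zero_iff.1 h2)
    · obtain ⟨B, hB, h⟩ := hsel z
      exact ⟨⟨B, hB⟩, h⟩
  refine Set.Finite.of_injOn (f := fun φ => fun τ : T => φ (r τ))
    (t := Set.pi univ fun τ : T => (fun A : (Fin n → ℝ) →ᵃ[ℝ] (Fin m → ℝ) => A (r τ)) '' s)
    ?_ ?_ (Set.Finite.pi fun τ => hs.image _)
  · rintro φ ⟨-, hφ⟩ τ -
    obtain ⟨A, hA, h⟩ := hφ (r τ)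
    exact ⟨A, hA, h.symm⟩
  · rintro φ ⟨hφ, hφs⟩ ψ ⟨hψ, hψs⟩ heq
    funext x
    let τ : T := ⟨sg x, x, rfl⟩
    obtain ⟨A, hA, h⟩ := hφs (r τ)
    have h' : ψ (r τ) = A (r τ) := (congrFun heq τ).symm.trans h
    rw [key φ hφ hφs (r τ) x (hr τ) A hA h, key ψ hψ hψs (r τ) x (hr τ) A hA h']

/-- If finitely many closed sets cover a regular closed set, those with nonempty interior
already cover it. -/
theorem exists_mem_nonempty_interior_of_cover {X ι : Type*} [TopologicalSpace X] [BaireSpace X]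
    [Finite ι] {R : Set X} (hR : closure (interior R) = R) {E : ι → Set X}
    (hE : ∀ i, IsClosed (E i)) (hcov : R ⊆ ⋃ i, E i) {x : X} (hx : x ∈ R) :
    ∃ i, x ∈ E i ∧ (interior (E i)).Nonempty := by
  by_contra! hcon
  let U : Set X := (⋃ i : {i // (interior (E i)).Nonempty}, E i)ᶜ
  have hU : IsOpen U := (isClosed_iUnion_of_finite fun i => hE _).isOpen_compl
  have hxU : x ∈ U := by
    simp only [U, mem_compl_iff, mem_iUnion, not_exists]
    rintro ⟨i, hi⟩ hxi
    exact hi.ne_empty (hcon i hxi)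
  let F : Option ι → Set X := fun o => o.elim (interior R)ᶜ E
  have hF : Dense (⋃ o, interior (F o)) := by
    have := Fintype.ofFinite ι
    refine dense_iUnion_interior_of_closed ?_ ?_
    · rintro (_ | i)
      · exact isOpen_interior.isClosed_compl
      · exact hE i
    · refine eq_univ_of_forall fun y => ?_
      by_cases hy : y ∈ interior R
      · obtain ⟨i, hi⟩ := mem_iUnion.1 (hcov (interior_subset hy))
        exact mem_iUnion.2 ⟨some i, hi⟩
      · exact mem_iUnion.2 ⟨none, hy⟩
  rw [← hR] at hx
  obtain ⟨y, ⟨hyU, hyR⟩, hy⟩ := hF.inter_open_nonempty _ (hU.inter isOpen_interior)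
    (mem_closure_iff.1 hx U hU hxU)
  obtain ⟨o, ho⟩ := mem_iUnion.1 hy
  cases o with
  | none => exact interior_subset ho hyR
  | some i => exact hyU (mem_iUnion.2 ⟨⟨i, y, ho⟩, interior_subset ho⟩)

theorem affine_rightInverse_subsingleton {n : ℕ} (G : (Fin n → ℝ) →ᵃ[ℝ] (Fin n → ℝ)) :
    {h : (Fin n → ℝ) →ᵃ[ℝ] (Fin n → ℝ) | G.comp h = AffineMap.id ℝ _}.Subsingleton := by
  intro h hh h' hh'
  have e : ∀ x, G (h x) = x := fun x => DFunLike.congr_fun hh x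
  have e' : ∀ x, G (h' x) = x := fun x => DFunLike.congr_fun hh' x
  have hsurj : Function.Surjective G := fun x => ⟨h x, e x⟩
  have hinj : Function.Injective G := by
    rw [← G.linear_injective_iff, LinearMap.injective_iff_surjective, G.linear_surjective_iff]
    exact hsurj
  ext1 x
  exact hinj ((e x).trans (e' x).symm)

/-- A continuous piecewise affine section over a regular closed set takes its values among the
affine right inverses of the affine pieces of the map it is a section of. -/
theorem section_selects_rightInverse {n : ℕ} {R C : Set (Fin n → ℝ)}
    (hR : closure (interior R) = R) {σ τ : (Fin n → ℝ) → (Fin n → ℝ)}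
    {s : Set ((Fin n → ℝ) →ᵃ[ℝ] (Fin n → ℝ))} (hs : s.Finite)
    (hσ : ∀ x ∈ C, ∃ A ∈ s, σ x = A x) (hτc : ContinuousOn τ R)
    (hτ : SelectsAffineOn R τ) (hmaps : MapsTo τ R C) (hsec : ∀ y ∈ R, σ (τ y) = y)
    {x : Fin n → ℝ} (hx : x ∈ R) :
    ∃ G ∈ s, ∃ h : (Fin n → ℝ) →ᵃ[ℝ] (Fin n → ℝ),
      G.comp h = AffineMap.id ℝ _ ∧ τ x = h x := by
  obtain ⟨t, ht, hτt⟩ := hτ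
  have : Finite s := hs
  have : Finite t := ht
  have hRc : IsClosed R := hR ▸ isClosed_closure
  let E : s × t → Set (Fin n → ℝ) := fun p =>
    {y ∈ R | τ y = p.2.1 y} ∩ {y | p.1.1 (p.2.1 y) = y}
  have hE : ∀ p, IsClosed (E p) := by
    intro p
    have c1 := p.1.1.continuous_of_finiteDimensional
    have c2 := p.2.1.continuous_of_finiteDimensional
    refine IsClosed.inter ?_ (isClosed_eq (c1.comp c2) continuous_id)
    exact (hτc.prodMk c2.continuousOn).preimage_isClosed_of_isClosed hRc isClosed_diagonal
  obtain ⟨⟨G, h⟩, hxE, hne⟩ := exists_mem_nonempty_interior_of_cover hR hE (fun y hy => by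
    obtain ⟨h, hh, hy'⟩ := hτt y hy
    obtain ⟨G, hG, hy''⟩ := hσ _ (hmaps hy)
    refine mem_iUnion.2 ⟨⟨⟨G, hG⟩, ⟨h, hh⟩⟩, ⟨hy, hy'⟩, ?_⟩
    change G (h y) = y
    rw [← hy', ← hy'', hsec y hy]) hx
  refine ⟨G, G.2, h, ?_, hxE.1.2⟩
  refine AffineMap.ext_on (isOpen_interior.affineSpan_eq_top hne) fun y hy => ?_
  exact (interior_subset hy).2

/-- The composites `τ ∘ σ`, for `τ` a continuous piecewise affine section of `σ` over its
range. -/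
def sectionComposites {n : ℕ} (σ : (Fin n → ℝ) → (Fin n → ℝ)) :
    Set (↥(cubeSet n) → (Fin n → ℝ)) :=
  {φ | ∃ τ : (Fin n → ℝ) → (Fin n → ℝ), ContinuousOn τ (zRange σ) ∧
    SelectsAffineOn (zRange σ) τ ∧ MapsTo τ (zRange σ) (cubeSet n) ∧
    (∀ y ∈ zRange σ, σ (τ y) = y) ∧ ∀ x, φ x = τ (σ x)}

theorem IsIntAffine.exists_affineMap {n m : ℕ} {g : (Fin n → ℝ) → (Fin m → ℝ)}
    (hg : IsIntAffine g) : ∃ A : (Fin n → ℝ) →ᵃ[ℝ] (Fin m → ℝ), ∀ x, g x = A x := by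
  obtain ⟨M, b, h⟩ := hg
  refine ⟨(Matrix.toLin' (Matrix.of fun i j => (M i j : ℝ))).toAffineMap +
    AffineMap.const ℝ _ (fun i => (b i : ℝ)), fun x => funext fun i => ?_⟩
  simp [h, Matrix.mulVec, dotProduct]

theorem IsZMapOn.selectsAffineOn {n m : ℕ} {P : Set (Fin n → ℝ)}
    {f : (Fin n → ℝ) → (Fin m → ℝ)} (hf : IsZMapOn P f) : SelectsAffineOn P f := by
  obtain ⟨-, k, g, hg, hfg⟩ := hf
  choose A hA using fun i => (hg i).exists_affineMap
  refine ⟨range A, finite_range A, fun x hx => ?_⟩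
  obtain ⟨i, hi⟩ := hfg x hx
  exact ⟨A i, mem_range_self i, hi.trans (hA i x)⟩

theorem finite_sectionComposites {n : ℕ} {σ : (Fin n → ℝ) → (Fin n → ℝ)}
    (hσ : IsZRetraction σ) (hcd : IsClosedDomain (zRange σ)) : (sectionComposites σ).Finite := by
  obtain ⟨s, hs, hσs⟩ := hσ.1.selectsAffineOn
  have hfin : (⋃ G ∈ s, {h : (Fin n → ℝ) →ᵃ[ℝ] (Fin n → ℝ) |
      G.comp h = AffineMap.id ℝ _}).Finite :=
    hs.biUnion fun G _ => (affine_rightInverse_subsingleton G).finite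
  refine (finite_continuous_affine_selections (C := cubeSet n) (convex_Icc 0 1)
    (hfin.image2 (fun h G : (Fin n → ℝ) →ᵃ[ℝ] (Fin n → ℝ) => h.comp G) hs)).subset ?_
  rintro φ ⟨τ, hτc, hτ, hmaps, hsec, hφ⟩
  have hmem : ∀ x : cubeSet n, σ x ∈ zRange σ := fun x => mem_image_of_mem _ x.2
  constructor
  · rw [show φ = fun x : cubeSet n => τ (σ x) from funext hφ]
    exact hτc.comp_continuous (continuousOn_iff_continuous_domRestrict.1 hσ.1.1) hmem
  · intro x
    obtain ⟨G, hG, h, hGh, hx⟩ :=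
      section_selects_rightInverse hcd hs hσs hτc hτ hmaps hsec (hmem x)
    obtain ⟨G', hG', hx'⟩ := hσs x x.2
    refine ⟨h.comp G', mem_image2_of_mem (mem_biUnion hG hGh) hG', ?_⟩
    rw [hφ, hx, hx']
    rfl

theorem IsZHomeoDomain.exists_eq_range {n : ℕ} {σ : (Fin n → ℝ) → (Fin n → ℝ)}
    {Q : Set (Fin n → ℝ)} (hQ : IsZHomeoDomain σ Q) :
    ∃ φ ∈ sectionComposites σ, range φ = Q := by
  obtain ⟨-, hQc, -, himg, -, τ, hτ, hl, hr⟩ := hQ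
  have hmaps : MapsTo τ (zRange σ) Q := by
    intro y hy
    rw [← himg] at hy
    obtain ⟨x, hx, rfl⟩ := hy
    rwa [hl x hx]
  refine ⟨fun x => τ (σ x), ⟨τ, hτ.1, hτ.selectsAffineOn, hmaps.mono_right hQc, hr,
    fun _ => rfl⟩, ?_⟩
  apply Subset.antisymm
  · rintro _ ⟨x, rfl⟩
    exact hmaps (mem_image_of_mem _ x.2)
  · intro x hx
    exact ⟨⟨x, hQc hx⟩, hl x hx⟩

/-- Every `[0,1]`-valued homomorphism on a nonempty MV-algebra of continuous functions on a
compact space is evaluation at a point. -/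
theorem exists_eq_eval_of_mvHom {X : Type*} [TopologicalSpace X] [CompactSpace X]
    {A : Set (X → ℝ)} (hne : A.Nonempty) (hcont : ∀ f ∈ A, Continuous f)
    (hmem : ∀ f ∈ A, ∀ x, f x ∈ Icc (0 : ℝ) 1)
    (hadd : ∀ f ∈ A, ∀ g ∈ A, mvAdd f g ∈ A) (hneg : ∀ f ∈ A, mvNeg f ∈ A)
    (χ : A → ℝ) (hχ : ∀ f, χ f ∈ Icc (0 : ℝ) 1)
    (hχadd : ∀ (f g : A) (h : mvAdd f.1 g.1 ∈ A), χ ⟨mvAdd f.1 g.1, h⟩ = min (χ f + χ g) 1)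
    (hχneg : ∀ (f : A) (h : mvNeg f.1 ∈ A), χ ⟨mvNeg f.1, h⟩ = 1 - χ f) :
    ∃ y, ∀ f : A, χ f = f.1 y := by
  let add : A → A → A := fun f g => ⟨mvAdd f.1 g.1, hadd _ f.2 _ g.2⟩
  let neg : A → A := fun f => ⟨mvNeg f.1, hneg _ f.2⟩
  have add_apply : ∀ f g x, (add f g).1 x = min (f.1 x + g.1 x) 1 := fun _ _ _ => rfl
  have neg_apply : ∀ f x, (neg f).1 x = 1 - f.1 x := fun _ _ => rfl
  have χ_add : ∀ f g, χ (add f g) = min (χ f + χ g) 1 := fun f g => hχadd f g _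
  have χ_neg : ∀ f, χ (neg f) = 1 - χ f := fun f => hχneg f _
  have χ_one : ∀ u : A, (∀ x, u.1 x = 1) → χ u = 1 := by
    intro u hu
    have : u = add u (neg u) := Subtype.ext (funext fun x => by simp [add_apply, neg_apply, hu])
    rw [this, χ_add, χ_neg]
    simp
  have exists_zero : ∀ f : A, χ f = 0 → ∃ x, f.1 x = 0 := by
    intro f hf
    by_contra! hf0
    obtain ⟨δ, hδ, hfδ⟩ := isCompact_univ.exists_forall_le' (hcont _ f.2).continuousOn
      (a := 0) fun x _ => lt_of_le_of_ne (hmem _ f.2 x).1 (hf0 x).symm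
    have iter : ∀ k : ℕ, ∃ g : A, χ g = 0 ∧ ∀ x, min (2 ^ k * δ) 1 ≤ g.1 x := by
      intro k
      induction k with
      | zero => exact ⟨f, hf, fun x => by simp [hfδ x (mem_univ x)]⟩
      | succ k ih =>
        obtain ⟨g, hg, hgx⟩ := ih
        refine ⟨add g g, by simp [χ_add, hg], fun x => ?_⟩
        have h0 := (hmem _ g.2 x).1
        rw [add_apply]
        refine le_min ?_ (min_le_right _ _)
        rcases min_le_iff.1 (hgx x) with h | h
        · exact (min_le_left _ _).trans (by rw [pow_succ]; linarith)
        · exact (min_le_right _ _).trans (by linarith)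
    obtain ⟨k, hk⟩ := pow_unbounded_of_one_lt (1 / δ) (one_lt_two)
    obtain ⟨g, hg, hgx⟩ := iter k
    have := χ_one g fun x => le_antisymm (hmem _ g.2 x).2 <| by
      have h1 : 1 ≤ 2 ^ k * δ := by
        rw [div_lt_iff₀ hδ] at hk
        exact hk.le
      simpa [h1] using hgx x
    linarith
  obtain ⟨y, hy⟩ : ∃ y, ∀ f : A, χ f = 0 → f.1 y = 0 := by
    let Z : {f : A // χ f = 0} → Set X := fun f => {x | f.1.1 x = 0}
    have hZc : ∀ f, IsClosed (Z f) := fun f => isClosed_eq (hcont _ f.1.2) continuous_const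
    have : Nonempty {f : A // χ f = 0} := by
      obtain ⟨f, hf⟩ := hne
      exact ⟨neg (add ⟨f, hf⟩ (neg ⟨f, hf⟩)), by simp [χ_add, χ_neg]⟩
    obtain ⟨y, hy⟩ := IsCompact.nonempty_iInter_of_directed_nonempty_isCompact_isClosed Z
      (fun f g => ⟨⟨add f.1 g.1, by simp [χ_add, f.2, g.2]⟩, by
        have aux : ∀ x, (add f.1 g.1).1 x = 0 → f.1.1 x = 0 ∧ g.1.1 x = 0 := by
          intro x hx
          have h1 := (hmem _ f.1.2 x).1
          have h2 := (hmem _ g.1.2 x).1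
          rw [add_apply] at hx
          rcases min_choice (f.1.1 x + g.1.1 x) 1 with h | h
          · constructor <;> linarith
          · linarith
        exact ⟨fun x hx => (aux x hx).1, fun x hx => (aux x hx).2⟩⟩)
      (fun f => exists_zero f.1 f.2) (fun f => (hZc f).isCompact) hZc
    exact ⟨y, fun f hf => mem_iInter.1 hy ⟨f, hf⟩⟩
  have gap : ∀ k : ℕ, ∀ f : A, ¬ 1 < 2 ^ k * (f.1 y - χ f) := by
    intro k
    induction k with
    | zero =>
      intro f
      have := (hmem _ f.2 y).2
      have := (hχ f).1
      simp only [pow_zero]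
      linarith
    | succ k ih =>
      intro f hlt
      have hpos : 0 < f.1 y - χ f := by
        by_contra! h
        have : (2 : ℝ) ^ (k + 1) * (f.1 y - χ f) ≤ 0 :=
          mul_nonpos_of_nonneg_of_nonpos (by positivity) h
        linarith
      let dbl := neg (add (neg f) (neg f))
      have dbl_apply : dbl.1 y = 1 - min ((1 - f.1 y) + (1 - f.1 y)) 1 := rfl
      have χ_dbl : χ dbl = 1 - min ((1 - χ f) + (1 - χ f)) 1 := by
        simp only [dbl, χ_neg, χ_add]
      rcases le_or_gt (f.1 y) (1 / 2) with h1 | h1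
      · refine ih (add f f) ?_
        rw [add_apply, χ_add, min_eq_left (by linarith), min_eq_left (by linarith)]
        rw [pow_succ] at hlt
        linarith
      rcases le_or_gt (χ f) (1 / 2) with h2 | h2
      · have h0 := hy dbl (by rw [χ_dbl, min_eq_right (by linarith)]; ring)
        rw [dbl_apply, min_eq_left (by linarith)] at h0
        linarith
      · refine ih dbl ?_
        rw [dbl_apply, χ_dbl, min_eq_left (by linarith), min_eq_left (by linarith)]
        rw [pow_succ] at hlt
        linarith
  have le : ∀ f : A, f.1 y ≤ χ f := by
    intro f
    by_contra! h
    obtain ⟨k, hk⟩ := pow_unbounded_of_one_lt (1 / (f.1 y - χ f)) (one_lt_two)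
    rw [div_lt_iff₀ (sub_pos.2 h)] at hk
    exact gap k f hk
  refine ⟨y, fun f => le_antisymm ?_ (le f)⟩
  have := le (neg f)
  rw [neg_apply, χ_neg] at this
  linarith

theorem isZMapOn1_of_finite {n : ℕ} {ι : Type*} [Finite ι] {P : Set (Fin n → ℝ)}
    {f : (Fin n → ℝ) → ℝ} (hf : ContinuousOn f P) (g : ι → (Fin n → ℝ) → ℝ)
    (hg : ∀ i, IsIntAffine1 (g i)) (hfg : ∀ x ∈ P, ∃ i, f x = g i x) : IsZMapOn1 P f := by
  have := Fintype.ofFinite ι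
  refine ⟨hf, Fintype.card ι, g ∘ (Fintype.equivFin ι).symm, fun i => hg _, fun x hx => ?_⟩
  obtain ⟨i, hi⟩ := hfg x hx
  exact ⟨Fintype.equivFin ι i, by simpa using hi⟩

theorem isIntAffine1_const_one (n : ℕ) : IsIntAffine1 (fun _ : Fin n → ℝ => (1 : ℝ)) :=
  ⟨0, 1, fun x => by simp⟩

theorem IsIntAffine1.add {n : ℕ} {f g : (Fin n → ℝ) → ℝ} (hf : IsIntAffine1 f)
    (hg : IsIntAffine1 g) : IsIntAffine1 (fun x => f x + g x) := by
  obtain ⟨m, b, hf⟩ := hf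
  obtain ⟨m', b', hg⟩ := hg
  refine ⟨m + m', b + b', fun x => ?_⟩
  simp only [hf, hg, Pi.add_apply, Int.cast_add, add_mul, Finset.sum_add_distrib]
  ring

theorem IsIntAffine1.one_sub {n : ℕ} {f : (Fin n → ℝ) → ℝ} (hf : IsIntAffine1 f) :
    IsIntAffine1 (fun x => 1 - f x) := by
  obtain ⟨m, b, hf⟩ := hf
  refine ⟨-m, 1 - b, fun x => ?_⟩
  simp only [hf, Pi.neg_apply, Int.cast_neg, neg_mul, Finset.sum_neg_distrib, Int.cast_sub,
    Int.cast_one]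
  ring

theorem IsIntAffine1.exists_affineMap {n : ℕ} {g : (Fin n → ℝ) → ℝ}
    (hg : IsIntAffine1 g) : ∃ A : (Fin n → ℝ) →ᵃ[ℝ] ℝ, ∀ x, g x = A x := by
  obtain ⟨m, b, h⟩ := hg
  refine ⟨(∑ j, (m j : ℝ) • LinearMap.proj j : (Fin n → ℝ) →ₗ[ℝ] ℝ).toAffineMap +
    AffineMap.const ℝ _ (b : ℝ), fun x => ?_⟩
  simp [h]

theorem IsIntAffine.coord {n m : ℕ} {g : (Fin n → ℝ) → (Fin m → ℝ)} (hg : IsIntAffine g)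
    (i : Fin m) : IsIntAffine1 (fun x => g x i) := by
  obtain ⟨M, b, h⟩ := hg
  exact ⟨M i, b i, fun x => h x i⟩

theorem IsZMapOn.coord {n m : ℕ} {P : Set (Fin n → ℝ)} {f : (Fin n → ℝ) → (Fin m → ℝ)}
    (hf : IsZMapOn P f) (i : Fin m) : IsZMapOn1 P (fun x => f x i) := by
  obtain ⟨hc, k, g, hg, hfg⟩ := hf
  refine ⟨(continuous_apply i).comp_continuousOn hc, k, fun j x => g j x i,
    fun j => (hg j).coord i, fun x hx => ?_⟩
  obtain ⟨j, hj⟩ := hfg x hx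
  exact ⟨j, congrFun hj i⟩

theorem selectsAffineOn_pi {n m : ℕ} {P : Set (Fin n → ℝ)} {f : Fin m → (Fin n → ℝ) → ℝ}
    (hf : ∀ i, IsZMapOn1 P (f i)) : SelectsAffineOn P (fun x i => f i x) := by
  choose hc k g hg hfg using hf
  choose A hA using fun i j => (hg i j).exists_affineMap
  refine ⟨range fun c : (i : Fin m) → Fin (k i) => AffineMap.pi fun i => A i (c i),
    finite_range _, fun x hx => ?_⟩
  choose c hc using fun i => hfg i x hx
  refine ⟨_, mem_range_self c, funext fun i => ?_⟩
  exact (hc i).trans (hA i (c i) x)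

theorem mem_McN_of_isZMapOn1 {n : ℕ} {g : (Fin n → ℝ) → ℝ} (hg : IsZMapOn1 (cubeSet n) g)
    (h01 : ∀ x ∈ cubeSet n, g x ∈ Icc (0 : ℝ) 1) : (fun x : cubeSet n => g x) ∈ McN n :=
  ⟨fun x => h01 x x.2, g, hg, fun _ => rfl⟩

theorem continuous_of_mem_McN {n : ℕ} {f : cubeSet n → ℝ} (hf : f ∈ McN n) : Continuous f := by
  obtain ⟨-, g, hg, hfg⟩ := hf
  rw [show f = fun x : cubeSet n => g x from funext hfg]
  exact continuousOn_iff_continuous_domRestrict.1 hg.1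

theorem mvAdd_mem_McN {n : ℕ} {f g : cubeSet n → ℝ} (hf : f ∈ McN n) (hg : g ∈ McN n) :
    mvAdd f g ∈ McN n := by
  obtain ⟨hf01, f', ⟨hfc, k, a, ha, hfa⟩, hff'⟩ := hf
  obtain ⟨hg01, g', ⟨hgc, l, b, hb, hgb⟩, hgg'⟩ := hg
  refine ⟨fun x => ⟨le_min (add_nonneg (hf01 x).1 (hg01 x).1) zero_le_one, min_le_right _ _⟩,
    fun x => min (f' x + g' x) 1, ?_, fun x => by simp [mvAdd, hff', hgg']⟩
  refine isZMapOn1_of_finite (ι := Option (Fin k × Fin l))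
    (ContinuousOn.inf (hfc.add hgc) continuousOn_const)
    (fun o x => o.elim 1 fun p => a p.1 x + b p.2 x) ?_ fun x hx => ?_
  · rintro (_ | p)
    · exact isIntAffine1_const_one n
    · exact (ha p.1).add (hb p.2)
  · obtain ⟨i, hi⟩ := hfa x hx
    obtain ⟨j, hj⟩ := hgb x hx
    rcases min_choice (f' x + g' x) 1 with h | h
    · exact ⟨some (i, j), h.trans (by rw [hi, hj]; rfl)⟩
    · exact ⟨none, h⟩

theorem mvNeg_mem_McN {n : ℕ} {f : cubeSet n → ℝ} (hf : f ∈ McN n) : mvNeg f ∈ McN n := by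
  obtain ⟨hf01, f', ⟨hfc, k, a, ha, hfa⟩, hff'⟩ := hf
  refine ⟨fun x => ⟨sub_nonneg.2 (hf01 x).2, sub_le_self _ (hf01 x).1⟩,
    fun x => 1 - f' x, ⟨continuousOn_const.sub hfc, k, fun i x => 1 - a i x,
      fun i => (ha i).one_sub, fun x hx => ?_⟩, fun x => by simp [mvNeg, hff']⟩
  obtain ⟨i, hi⟩ := hfa x hx
  exact ⟨i, congrArg (1 - ·) hi⟩

/-- The `i`-th coordinate function of a Z-map of the cube into itself, as an element of
`McN n`. -/
def coordMcN {n : ℕ} {f : (Fin n → ℝ) → (Fin n → ℝ)} (hf : IsZMapOn (cubeSet n) f)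
    (hmaps : MapsTo f (cubeSet n) (cubeSet n)) (i : Fin n) : McN n :=
  ⟨fun x => f x i, mem_McN_of_isZMapOn1 (hf.coord i)
    fun _ hx => ⟨(hmaps hx).1 i, (hmaps hx).2 i⟩⟩

theorem isZMapOn_id {n : ℕ} (P : Set (Fin n → ℝ)) : IsZMapOn P (fun x => x) := by
  classical
  exact ⟨continuousOn_id, 1, fun _ x => x,
    fun _ => ⟨fun i j => if i = j then 1 else 0, 0, fun x i => by simp⟩, fun x _ => ⟨0, rfl⟩⟩

/-- The `i`-th coordinate projection of the cube. -/
def projMcN {n : ℕ} (i : Fin n) : McN n :=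
  coordMcN (isZMapOn_id (cubeSet n)) (mapsTo_id _) i

/-- A retraction of `McN n` is substitution of the images of the coordinate projections. -/
theorem IsMcNRetraction.exists_point {n : ℕ} {ε : McN n → McN n} {A : Set (cubeSet n → ℝ)}
    (hε : IsMcNRetraction ε A) (x : cubeSet n) :
    ∃ y : cubeSet n, (y : Fin n → ℝ) = (fun i => (ε (projMcN i)).1 x) ∧
      ∀ f, (ε f).1 x = f.1 y := by
  have : CompactSpace (cubeSet n) := isCompact_iff_compactSpace.1 isCompact_Icc
  obtain ⟨y, hy⟩ := exists_eq_eval_of_mvHom (A := McN n)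
    ⟨_, mem_McN_of_isZMapOn1 ⟨continuousOn_const, 1, fun _ _ => 1,
      fun _ => isIntAffine1_const_one n, fun _ _ => ⟨0, rfl⟩⟩ fun _ _ => ⟨zero_le_one, le_rfl⟩⟩
    (fun f hf => continuous_of_mem_McN hf) (fun f hf => hf.1) (fun f hf g hg => mvAdd_mem_McN hf hg)
    (fun f hf => mvNeg_mem_McN hf) (fun f => (ε f).1 x) (fun f => (ε f).2.1 x)
    (fun f g h => congrFun (hε.1 f g h) x) (fun f h => congrFun (hε.2.1 f h) x)
  exact ⟨y, funext fun i => (hy (projMcN i)).symm, hy⟩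

theorem IsMcNRetraction.mem_sectionComposites {n : ℕ} {σ : (Fin n → ℝ) → (Fin n → ℝ)}
    (hσ : IsZRetraction σ) {ε : McN n → McN n} (hε : IsMcNRetraction ε (retAlg σ)) :
    (fun x i => (ε (projMcN i)).1 x) ∈ sectionComposites σ := by
  have hrange : ∀ i, (ε (projMcN i)).1 ∈ retAlg σ := fun i =>
    hε.2.2.2 ▸ mem_image_of_mem _ (mem_range_self _)
  choose g hg hεg using hrange
  choose hg01 G hG hgG using hg
  have hsub : zRange σ ⊆ cubeSet n := hσ.2.1.image_subset
  have heq : ∀ x : cubeSet n, (fun i => (ε (projMcN i)).1 x) = fun i => G i (σ x) :=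
    fun x => funext fun i => (hεg i x (hσ.2.1 x.2)).trans (hgG i _)
  refine ⟨fun y i => G i y, ?_, ?_, ?_, ?_, heq⟩
  · exact continuousOn_pi.2 fun i => (hG i).1.mono hsub
  · exact selectsAffineOn_pi fun i => ⟨(hG i).1.mono hsub, (hG i).2.imp fun k ⟨a, ha, h⟩ =>
      ⟨a, ha, fun x hx => h x (hsub hx)⟩⟩
  · rintro _ ⟨x, hx, rfl⟩
    obtain ⟨y, hy, -⟩ := hε.exists_point ⟨x, hx⟩
    have hyσ : (y : Fin n → ℝ) = fun i => G i (σ x) := hy.trans (heq ⟨x, hx⟩)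
    exact mem_of_eq_of_mem hyσ.symm y.2
  · rintro _ ⟨x, hx, rfl⟩
    obtain ⟨y, hy, hεy⟩ := hε.exists_point ⟨x, hx⟩
    change σ (fun i => G i (σ x)) = σ x
    have hyσ : (y : Fin n → ℝ) = fun i => G i (σ x) := hy.trans (heq ⟨x, hx⟩)
    rw [← hyσ]
    funext i
    have hmem : (coordMcN hσ.1 hσ.2.1 i).1 ∈ retAlg σ :=
      ⟨(projMcN i).1, (projMcN i).2, fun _ _ => rfl⟩
    rw [← hε.2.2.2] at hmem
    obtain ⟨_, ⟨f, rfl⟩, hf⟩ := hmem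
    have hfix : ε (coordMcN hσ.1 hσ.2.1 i) = coordMcN hσ.1 hσ.2.1 i := by
      rw [← Subtype.ext hf, hε.2.2.1]
    have := hεy (coordMcN hσ.1 hσ.2.1 i)
    rw [hfix] at this
    exact this.symm

/-- If `σ` is a Z-retraction of the cube whose range is a closed domain, then
there are only finitely many retractions of `McN([0,1]^n)` onto `A_σ`; equivalently, only
finitely many Z-homeomorphism domains for `σ`. -/
theorem stmt3 {n : ℕ} (hn : 1 ≤ n) (σ : (Fin n → ℝ) → (Fin n → ℝ))
    (hσ : IsZRetraction σ) (hcd : IsClosedDomain (zRange σ)) :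
    {ε : ↥(McN n) → ↥(McN n) | IsMcNRetraction ε (retAlg σ)}.Finite ∧
    {Q : Set (Fin n → ℝ) | IsZHomeoDomain σ Q}.Finite := by
  have hfin := finite_sectionComposites hσ hcd
  constructor
  · refine Set.Finite.of_injOn (f := fun ε x i => (ε (projMcN i)).1 x)
      (fun ε hε => IsMcNRetraction.mem_sectionComposites hσ hε) (fun ε hε ε' hε' heq => ?_) hfin
    funext f
    refine Subtype.ext (funext fun x => ?_)
    obtain ⟨y, hy, hεy⟩ := IsMcNRetraction.exists_point hε x
    obtain ⟨y', hy', hεy'⟩ := IsMcNRetraction.exists_point hε' x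
    have : y = y' := Subtype.ext (hy.trans ((congrFun heq x).trans hy'.symm))
    rw [hεy, hεy', this]
  · exact (hfin.image range).subset fun Q hQ => IsZHomeoDomain.exists_eq_range hQ
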